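/- Let A be a ℤ-graded k-algebra and φ a graded degree-zero algebra automorphism of A. Define the k-linear map ψ : A → A by ψ(a) = φ^{-i}(a) for a ∈ A_i, extended linearly. Then ψ is a degree-preserving k-linear bijection which is an isomorphism of graded algebras from the right Zhang twist A^φ to the left Zhang twist ^{φ^{-1}}A; concretely, ψ(1) = 1 and for all a ∈ A_i, b ∈ A_j one has φ^{-(i+j)}(a · φ^i(b)) = φ^{-j}(φ^{-i}(a)) · φ^{-j}(b). -/

import Mathlib

/-!
Statement 2: For a `ℤ`-graded `k`-algebra `A` and a graded degree-zero automorphism `φ`,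
the map `ψ` defined on homogeneous elements by `ψ(a) = φ^{-i}(a)` for `a ∈ A_i` is a
degree-preserving `k`-linear bijection which is an isomorphism of graded algebras from
the right Zhang twist `A^φ` to the left Zhang twist `^{φ⁻¹}A`.
-/

section

variable {k A : Type*} [Field k] [Ring A] [Algebra k A]

/-- The linear endomorphism acting on the `i`-th graded piece as `f i`. -/
noncomputable def gradedPiecewise (𝒜 : ℤ → Submodule k A) [DirectSum.Decomposition 𝒜]
    (f : ℤ → A →ₗ[k] A) : A →ₗ[k] A :=
  (DirectSum.toModule k ℤ A fun i => f i ∘ₗ (𝒜 i).subtype) ∘ₗ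
    (DirectSum.decomposeLinearEquiv 𝒜).toLinearMap

theorem gradedPiecewise_apply_of_mem (𝒜 : ℤ → Submodule k A) [DirectSum.Decomposition 𝒜]
    (f : ℤ → A →ₗ[k] A) {i : ℤ} {a : A} (ha : a ∈ 𝒜 i) :
    gradedPiecewise 𝒜 f a = f i a := by
  have h : DirectSum.decomposeLinearEquiv 𝒜 a = DirectSum.lof k ℤ (fun i => 𝒜 i) i ⟨a, ha⟩ :=
    DirectSum.decompose_of_mem 𝒜 ha
  simp [gradedPiecewise, h]

theorem linearMap_eq_of_eqOn_homogeneous (𝒜 : ℤ → Submodule k A) [DirectSum.Decomposition 𝒜]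
    {f g : A →ₗ[k] A} (h : ∀ i, ∀ a ∈ 𝒜 i, f a = g a) : f = g := by
  ext a
  induction a using DirectSum.Decomposition.inductionOn 𝒜 with
  | zero => simp
  | homogeneous a => exact h _ a a.2
  | add a b ha hb => simp [ha, hb]

theorem algEquiv_zpow_apply_mem {p : Submodule k A} {φ : A ≃ₐ[k] A}
    (hφ : Submodule.map φ.toLinearMap p = p) (m : ℤ) {a : A} (ha : a ∈ p) :
    (φ ^ m) a ∈ p := by
  have hf : ∀ b ∈ p, φ b ∈ p := fun b hb => hφ ▸ Submodule.mem_map_of_mem hb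
  have hb : ∀ b ∈ p, φ⁻¹ b ∈ p := by
    intro b hb
    rw [← hφ] at hb
    obtain ⟨c, hc, rfl⟩ := hb
    simpa [← AlgEquiv.mul_apply] using hc
  induction m generalizing a with
  | zero => simpa using ha
  | succ n ih =>
    rw [zpow_add_one, AlgEquiv.mul_apply]
    exact ih (hf a ha)
  | pred n ih =>
    rw [zpow_sub_one, AlgEquiv.mul_apply]
    exact ih (hb a ha)

end

theorem right_zhang_twist_iso_left_zhang_twist
    {k A : Type*} [Field k] [Ring A] [Algebra k A]
    (𝒜 : ℤ → Submodule k A) [DirectSum.Decomposition 𝒜]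
    (hone : (1 : A) ∈ 𝒜 0)
    (hmul : ∀ (i j : ℤ) (a b : A), a ∈ 𝒜 i → b ∈ 𝒜 j → a * b ∈ 𝒜 (i + j))
    (φ : A ≃ₐ[k] A)
    (hφ : ∀ n : ℤ, Submodule.map (φ.toLinearMap) (𝒜 n) = 𝒜 n) :
    ∃ ψ : A ≃ₗ[k] A,
      -- `ψ` is given on homogeneous elements by `a ↦ φ^{-i} a`
      (∀ (i : ℤ) (a : A), a ∈ 𝒜 i → ψ a = (φ ^ (-i)) a) ∧
      -- `ψ` is degree-preserving
      (∀ (i : ℤ) (a : A), a ∈ 𝒜 i → ψ a ∈ 𝒜 i) ∧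
      -- `ψ` is unital
      ψ 1 = 1 ∧
      -- `ψ` intertwines the right Zhang twist multiplication with the left one for `φ⁻¹`
      (∀ (i j : ℤ) (a b : A), a ∈ 𝒜 i → b ∈ 𝒜 j →
        (φ ^ (-(i + j))) (a * (φ ^ i) b) = (φ ^ (-j)) ((φ ^ (-i)) a) * (φ ^ (-j)) b) := by
  have hmem (m : ℤ) {i : ℤ} {a : A} (ha : a ∈ 𝒜 i) : (φ ^ m) a ∈ 𝒜 i :=
    algEquiv_zpow_apply_mem (hφ i) m ha
  let F : A →ₗ[k] A := gradedPiecewise 𝒜 fun i => (φ ^ (-i)).toLinearMap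
  let G : A →ₗ[k] A := gradedPiecewise 𝒜 fun i => (φ ^ i).toLinearMap
  have hF {i : ℤ} {a : A} (ha : a ∈ 𝒜 i) : F a = (φ ^ (-i)) a :=
    gradedPiecewise_apply_of_mem 𝒜 _ ha
  have hG {i : ℤ} {a : A} (ha : a ∈ 𝒜 i) : G a = (φ ^ i) a :=
    gradedPiecewise_apply_of_mem 𝒜 _ ha
  have hFG : F ∘ₗ G = LinearMap.id := linearMap_eq_of_eqOn_homogeneous 𝒜 fun i a ha => by
    rw [LinearMap.comp_apply, hG ha, hF (hmem i ha), ← AlgEquiv.mul_apply, ← zpow_add]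
    simp
  have hGF : G ∘ₗ F = LinearMap.id := linearMap_eq_of_eqOn_homogeneous 𝒜 fun i a ha => by
    rw [LinearMap.comp_apply, hF ha, hG (hmem (-i) ha), ← AlgEquiv.mul_apply, ← zpow_add]
    simp
  refine ⟨LinearEquiv.ofLinearMap F G hFG hGF, fun i a ha => hF ha, fun i a ha => ?_, ?_,
    fun i j a b _ _ => ?_⟩
  · rw [LinearEquiv.coe_ofLinearMap, hF ha]
    exact hmem _ ha
  · rw [LinearEquiv.coe_ofLinearMap, hF hone, map_one]
  · rw [map_mul, ← AlgEquiv.mul_apply, ← AlgEquiv.mul_apply, ← zpow_add, ← zpow_add]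
    congr 3 <;> ring
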